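/- There is no graph Γ ∈ 𝒢₃(θ0,θ1,θ2) with a vertex u and a partition of the remaining vertices into nonempty sets V2 and V3 such that: the induced subgraphs Γ[V2] and Γ[V3] are each complete or edgeless; u is adjacent to all vertices of V2 or to none of them; u is adjacent to all vertices of V3 or to none of them; the bipartite graph between V2 and V3 is biregular (every vertex of V2 has the same number of neighbours in V3, and every vertex of V3 has the same number of neighbours in V2); and the degree of u, the common degree of the vertices of V2, and the common degree of the vertices of V3 are pairwise distinct. -/

import Mathlib

/-- `θ` is an eigenvalue of the (real) adjacency matrix of `G`. -/
def adjEig {V : Type} [Fintype V] [DecidableEq V] (G : SimpleGraph V) [DecidableRel G.Adj]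
    (θ : ℝ) : Prop :=
  ∃ f : V → ℝ, f ≠ 0 ∧ (SimpleGraph.adjMatrix ℝ G).mulVec f = θ • f

/-- `Γ ∈ 𝒢₃(θ0,θ1,θ2)`: `Γ` is connected and the set of eigenvalues of its adjacency
matrix is exactly `{θ0, θ1, θ2}`, where `θ0 > θ1 > θ2`. -/
def InG3 {V : Type} [Fintype V] [DecidableEq V] (G : SimpleGraph V) [DecidableRel G.Adj]
    (θ0 θ1 θ2 : ℝ) : Prop :=
  G.Connected ∧ θ1 < θ0 ∧ θ2 < θ1 ∧ {θ : ℝ | adjEig G θ} = {θ0, θ1, θ2}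

open Matrix in
theorem Matrix.IsHermitian.eq_zero_of_mulVec_eigenvectorBasis {V : Type*} [Fintype V]
    [DecidableEq V] {A B : Matrix V V ℝ} (hA : A.IsHermitian)
    (h : ∀ i, B *ᵥ (hA.eigenvectorBasis i).ofLp = 0) : B = 0 := by
  have : Matrix.toEuclideanLin B = 0 := by
    refine hA.eigenvectorBasis.toBasis.ext fun i => ?_
    simp [Matrix.toLpLin_apply, h i]
  simpa using this

open Matrix in
theorem InG3.adjMatrix_cubic {V : Type} [Fintype V] [DecidableEq V] {G : SimpleGraph V}
    [DecidableRel G.Adj] {θ0 θ1 θ2 : ℝ} (h : InG3 G θ0 θ1 θ2) :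
    (G.adjMatrix ℝ - θ0 • 1) * ((G.adjMatrix ℝ - θ1 • 1) * (G.adjMatrix ℝ - θ2 • 1)) = 0 := by
  have hA : (G.adjMatrix ℝ).IsHermitian := by
    simp [IsHermitian, conjTranspose_eq_transpose_of_trivial]
  refine hA.eq_zero_of_mulVec_eigenvectorBasis fun i => ?_
  have hi := hA.mulVec_eigenvectorBasis i
  have hne : (hA.eigenvectorBasis i).ofLp ≠ 0 := by
    simpa using hA.eigenvectorBasis.orthonormal.ne_zero i
  have hmem : hA.eigenvalues i ∈ {θ : ℝ | adjEig G θ} := ⟨_, hne, hi⟩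
  rw [h.2.2.2] at hmem
  have key : ∀ θ : ℝ, (G.adjMatrix ℝ - θ • 1) *ᵥ (hA.eigenvectorBasis i).ofLp
      = (hA.eigenvalues i - θ) • (hA.eigenvectorBasis i).ofLp := fun θ => by
    rw [sub_mulVec, hi, smul_mulVec, one_mulVec, sub_smul]
  simp only [← mulVec_mulVec, key, mulVec_smul, smul_smul]
  simp only [Set.mem_insert_iff, Set.mem_singleton_iff] at hmem
  rcases hmem with h | h | h <;> simp [h]

open Matrix in
theorem InG3.posSemidef {V : Type} [Fintype V] [DecidableEq V] {G : SimpleGraph V}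
    [DecidableRel G.Adj] {θ0 θ1 θ2 : ℝ} (h : InG3 G θ0 θ1 θ2) :
    (θ0 • 1 - G.adjMatrix ℝ).PosSemidef := by
  have hB : (θ0 • 1 - G.adjMatrix ℝ).IsHermitian := by
    simp [IsHermitian, conjTranspose_eq_transpose_of_trivial]
  rw [hB.posSemidef_iff_eigenvalues_nonneg]
  intro i
  have hi := hB.mulVec_eigenvectorBasis i
  have hne : (hB.eigenvectorBasis i).ofLp ≠ 0 := by
    simpa using hB.eigenvectorBasis.orthonormal.ne_zero i
  have hmem : θ0 - hB.eigenvalues i ∈ {θ : ℝ | adjEig G θ} := by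
    refine ⟨_, hne, ?_⟩
    rw [sub_mulVec, smul_mulVec, one_mulVec] at hi
    rw [sub_smul, ← hi, sub_sub_cancel]
  rw [h.2.2.2] at hmem
  have h1 := h.2.1
  have h2 := h.2.2.1
  simp only [Pi.zero_apply]
  simp only [Set.mem_insert_iff, Set.mem_singleton_iff] at hmem
  rcases hmem with h | h | h <;> linarith

open Matrix in
theorem SimpleGraph.Connected.pos_of_adjMatrix_mulVec {V : Type} [Fintype V]
    {G : SimpleGraph V} [DecidableRel G.Adj] (hG : G.Connected) {θ : ℝ} {w : V → ℝ}
    (hw : G.adjMatrix ℝ *ᵥ w = θ • w) (hw0 : ∀ x, 0 ≤ w x) (hne : w ≠ 0) (x : V) : 0 < w x := by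
  have step : ∀ y z, G.Adj y z → w y = 0 → w z = 0 := by
    intro y z hyz hy
    have h := congrFun hw y
    rw [SimpleGraph.adjMatrix_mulVec_apply] at h
    simp only [Pi.smul_apply, hy, smul_zero] at h
    rw [Finset.sum_eq_zero_iff_of_nonneg fun z _ => hw0 z] at h
    exact h z (by simpa using hyz)
  refine (hw0 x).lt_of_ne fun hx => hne (funext fun y => ?_)
  obtain ⟨p⟩ := hG.preconnected x y
  have walk : ∀ {a b : V} (_ : G.Walk a b), w a = 0 → w b = 0 := by
    intro a b p
    induction p with
    | nil => exact id
    | cons hadj _ ih => exact fun ha => ih (step _ _ hadj ha)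
  exact walk p hx.symm

open Matrix in
theorem InG3.abs_eigenvector {V : Type} [Fintype V] [DecidableEq V] {G : SimpleGraph V}
    [DecidableRel G.Adj] {θ0 θ1 θ2 : ℝ} (h : InG3 G θ0 θ1 θ2) {v : V → ℝ}
    (hv : G.adjMatrix ℝ *ᵥ v = θ0 • v) :
    G.adjMatrix ℝ *ᵥ (fun x => |v x|) = θ0 • fun x => |v x| := by
  have hps := h.posSemidef
  set w : V → ℝ := fun x => |v x| with hw
  have hv0 : star v ⬝ᵥ (θ0 • 1 - G.adjMatrix ℝ) *ᵥ v = 0 := by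
    simp [sub_mulVec, smul_mulVec, hv]
  have hle : star w ⬝ᵥ (θ0 • 1 - G.adjMatrix ℝ) *ᵥ w
      ≤ star v ⬝ᵥ (θ0 • 1 - G.adjMatrix ℝ) *ᵥ v := by
    simp only [sub_mulVec, smul_mulVec, one_mulVec, dotProduct_sub, star_trivial]
    simp only [dotProduct, SimpleGraph.adjMatrix_mulVec_apply, Pi.smul_apply, smul_eq_mul]
    refine sub_le_sub (le_of_eq ?_) ?_
    · refine Finset.sum_congr rfl fun x _ => ?_
      rw [mul_left_comm, abs_mul_abs_self, mul_left_comm]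
    · refine Finset.sum_le_sum fun x _ => ?_
      rw [Finset.mul_sum, Finset.mul_sum]
      refine Finset.sum_le_sum fun y _ => ?_
      rw [← abs_mul]
      exact le_abs_self _
  have hw0 := (hps.dotProduct_mulVec_zero_iff w).1
    (le_antisymm (hle.trans hv0.le) (hps.dotProduct_mulVec_nonneg w))
  rw [sub_mulVec, smul_mulVec, one_mulVec, sub_eq_zero] at hw0
  exact hw0.symm

open Matrix in
theorem InG3.eigenvector_apply_ne_zero {V : Type} [Fintype V] [DecidableEq V]
    {G : SimpleGraph V} [DecidableRel G.Adj] {θ0 θ1 θ2 : ℝ} (h : InG3 G θ0 θ1 θ2) {v : V → ℝ}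
    (hv : G.adjMatrix ℝ *ᵥ v = θ0 • v) (hne : v ≠ 0) (x : V) : v x ≠ 0 := by
  have := h.1.pos_of_adjMatrix_mulVec (h.abs_eigenvector hv) (fun x => abs_nonneg _)
    (fun h0 => hne (funext fun y => by simpa using congrFun h0 y)) x
  exact abs_pos.1 this

/-- For a connected graph with exactly three eigenvalues, `(A - θ1)(A - θ2)` is a rank one matrix
`α αᵀ` with `α` entrywise positive. -/
theorem InG3.exists_pos_rank_one {V : Type} [Fintype V] [DecidableEq V] {G : SimpleGraph V}
    [DecidableRel G.Adj] {θ0 θ1 θ2 : ℝ} (h : InG3 G θ0 θ1 θ2) :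
    ∃ α : V → ℝ, (∀ x, 0 < α x) ∧
      (G.adjMatrix ℝ - θ1 • 1) * (G.adjMatrix ℝ - θ2 • 1) = Matrix.vecMulVec α α := by
  open Matrix in
  set A := G.adjMatrix ℝ with hA
  have hAt : Aᵀ = A := by simp [hA]
  set M := (A - θ1 • 1) * (A - θ2 • 1) with hM
  have hMt : Mᵀ = M := by
    simp only [hM, transpose_mul, transpose_sub, hAt, transpose_smul, transpose_one]
    simp only [sub_mul, mul_sub, smul_mul_assoc, mul_smul_comm, one_mul, mul_one]
    module
  obtain ⟨v, hv0, hv⟩ : adjEig G θ0 := by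
    have : θ0 ∈ {θ : ℝ | adjEig G θ} := by rw [h.2.2.2]; simp
    exact this
  have hw := h.abs_eigenvector hv
  have hwpos : ∀ x, 0 < |v x| := fun x => abs_pos.2 (h.eigenvector_apply_ne_zero hv hv0 x)
  set w : V → ℝ := fun x => |v x| with hwdef
  replace hwpos : ∀ x, 0 < w x := hwpos
  have hcol : ∀ x z y, M x y * w z = M z y * w x := by
    intro x z y
    by_contra hne
    have heig : A *ᵥ (fun x => M x y) = θ0 • fun x => M x y := by
      have := h.adjMatrix_cubic
      rw [← hA, ← hM, sub_mul, sub_eq_zero, smul_mul_assoc, one_mul] at this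
      funext i
      exact congrFun (congrFun this i) y
    set f : V → ℝ := w z • (fun x => M x y) - M z y • w with hf
    have hfe : A *ᵥ f = θ0 • f := by
      rw [hf, mulVec_sub, mulVec_smul, mulVec_smul, heig, hw, smul_sub, smul_comm θ0 (w z),
        smul_comm θ0 (M z y)]
    refine h.eigenvector_apply_ne_zero hfe (fun h0 => hne ?_) z ?_
    · have := congrFun h0 x
      simp [hf] at this
      linarith
    · simp [hf]; ring
  have hMw : M *ᵥ w = ((θ0 - θ1) * (θ0 - θ2)) • w := by
    have key : ∀ θ : ℝ, (A - θ • 1) *ᵥ w = (θ0 - θ) • w := fun θ => by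
      rw [sub_mulVec, hw, smul_mulVec, one_mulVec, sub_smul]
    rw [hM, ← mulVec_mulVec, key, mulVec_smul, key, smul_smul, mul_comm]
  have hκ : 0 < (θ0 - θ1) * (θ0 - θ2) :=
    mul_pos (by linarith [h.2.1]) (by linarith [h.2.1, h.2.2.1])
  set κ := (θ0 - θ1) * (θ0 - θ2)
  obtain ⟨x0⟩ := h.1.nonempty
  set c := M x0 x0 / (w x0 * w x0) with hc
  have hMc : ∀ x y, M x y = c * (w x * w y) := by
    intro x y
    have h1 := hcol x x0 y
    have h2 := hcol y x0 x0
    have h3 : M x0 y = M y x0 := congrFun (congrFun hMt y) x0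
    have h0 := (hwpos x0).ne'
    rw [h3] at h1
    rw [hc]
    field_simp
    linear_combination w x0 * h1 + w x * h2
  have hcpos : 0 < c := by
    have h1 := congrFun hMw x0
    simp only [mulVec, dotProduct, hMc, Pi.smul_apply, smul_eq_mul] at h1
    have h2 : c * (w x0 * ∑ y, w y * w y) = κ * w x0 := by
      rw [← h1, Finset.mul_sum, Finset.mul_sum]
      exact Finset.sum_congr rfl fun y _ => by ring
    refine pos_of_mul_pos_left (h2 ▸ mul_pos hκ (hwpos x0)) ?_
    exact mul_nonneg (hwpos x0).le (Finset.sum_nonneg fun y _ => mul_self_nonneg _)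
  refine ⟨fun x => √c * w x, fun x => mul_pos (Real.sqrt_pos.2 hcpos) (hwpos x), ?_⟩
  ext x y
  rw [hMc, vecMulVec_apply]
  linear_combination -(w x * w y) * Real.mul_self_sqrt hcpos.le

/-- The relations satisfied by the parameters of a partition `{u} ∪ V₂ ∪ V₃` of the vertices of a
graph into complete or edgeless parts, biregular to each other, when
`(A - θ₁)(A - θ₂) = α αᵀ`, where `s = -θ₁θ₂`, `t = θ₁ + θ₂` and `α` takes the values `a`, `b`, `c`
on the three parts. Here `k, l` record whether `V₂, V₃` are complete, `e, f` whether
`u` is joined to `V₂, V₃`, and `m, n` are the sizes of `V₂, V₃`; a vertex of `V₂` has `p` neighbours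
in `V₃` and a vertex of `V₃` has `q` neighbours in `V₂`. -/
structure PartitionRelations (k l e f : ℝ) (m n p q : ℕ) (s t a b c : ℝ) : Prop where
  a_pos : 0 < a
  b_pos : 0 < b
  c_pos : 0 < c
  a_ne_b : a ≠ b
  a_ne_c : a ≠ c
  b_ne_c : b ≠ c
  m_pos : 1 ≤ m
  n_pos : 1 ≤ n
  p_le : p ≤ n
  q_le : q ≤ m
  count : m * p = n * q
  deg_u : e * m + f * n = a ^ 2 + s
  deg_two : e + k * (m - 1) + p = b ^ 2 + s
  deg_three : f + l * (n - 1) + q = c ^ 2 + s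
  u_two : e * k * (m - 1) + f * p = e * t + a * b
  u_three : f * l * (n - 1) + e * q = f * t + a * c
  two_two : 2 ≤ m → ∃ r : ℕ, r ≤ p ∧ 2 * p ≤ n + r ∧ e + k * (m - 2) + r = k * t + b ^ 2
  three_three : 2 ≤ n → ∃ r : ℕ, r ≤ q ∧ 2 * q ≤ m + r ∧ f + l * (n - 2) + r = l * t + c ^ 2
  adj_two_three : 0 < p → e * f + k * (q - 1) + l * (p - 1) = t + b * c
  not_adj_two_three : p < n → e * f + k * q + l * p = b * c

namespace PartitionRelations

variable {k l e f : ℝ} {m n p q : ℕ} {s t a b c : ℝ}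

theorem p_pos_iff (h : PartitionRelations k l e f m n p q s t a b c) : 0 < p ↔ 0 < q := by
  have h1 := h.count
  have h2 := h.m_pos
  have h3 := h.n_pos
  constructor
  · intro hp
    have := Nat.mul_pos h2 hp
    exact Nat.pos_of_mul_pos_left (h1 ▸ this)
  · intro hp
    have := Nat.mul_pos h3 hp
    exact Nat.pos_of_mul_pos_left (h1 ▸ this)

theorem p_eq_iff (h : PartitionRelations k l e f m n p q s t a b c) : p = n ↔ q = m := by
  have h1 := h.count
  constructor
  · rintro rfl
    exact (Nat.eq_of_mul_eq_mul_left h.n_pos (by linarith))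
  · rintro rfl
    exact (Nat.eq_of_mul_eq_mul_left h.m_pos (by linarith))

theorem swap (h : PartitionRelations k l e f m n p q s t a b c) :
    PartitionRelations l k f e n m q p s t a c b where
  a_pos := h.a_pos
  b_pos := h.c_pos
  c_pos := h.b_pos
  a_ne_b := h.a_ne_c
  a_ne_c := h.a_ne_b
  b_ne_c := h.b_ne_c.symm
  m_pos := h.n_pos
  n_pos := h.m_pos
  p_le := h.q_le
  q_le := h.p_le
  count := h.count.symm
  deg_u := by linarith [h.deg_u]
  deg_two := h.deg_three
  deg_three := h.deg_two
  u_two := h.u_three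
  u_three := h.u_two
  two_two := h.three_three
  three_three := h.two_two
  adj_two_three hq := by linarith [h.adj_two_three (h.p_pos_iff.2 hq)]
  not_adj_two_three hq := by
    have hp : p < n := h.p_le.lt_of_ne fun hp => hq.ne (h.p_eq_iff.1 hp)
    linarith [h.not_adj_two_three hp]

theorem trichotomy (h : PartitionRelations k l e f m n p q s t a b c) :
    (p = 0 ∧ q = 0) ∨ (p = n ∧ q = m) ∨ (0 < p ∧ 0 < q ∧ p < n ∧ q < m) := by
  have h1 := h.p_pos_iff
  have h2 := h.p_eq_iff
  have h3 := h.p_le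
  have h4 := h.q_le
  omega

theorem a_eq_add (h : PartitionRelations k l 1 1 m n p q s t a b c) : a = b + c := by
  have : (b - c) * (a - (b + c)) = 0 := by
    linear_combination h.u_three - h.u_two + h.deg_two - h.deg_three
  have := h.b_ne_c
  grind

theorem false_of_joined_both_of_edgeless_of_edgeless
    (h : PartitionRelations 0 0 1 1 m n p q s t a b c) : False := by
  obtain ⟨ha, hb, hc, hab, hac, hbc, hm, hn, -, -, -, hu, h2, h3, hu2, hu3, h22, h33, hadj, hnon⟩
    := id h
  rcases h.trichotomy with ⟨rfl, rfl⟩ | ⟨rfl, rfl⟩ | ⟨hp, hq, hpn, hqm⟩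
  · have : a * (b - c) = 0 := by push_cast at hu2 hu3; linarith
    grind
  · have hadj := hadj (by omega)
    have hs : s = 0 := by
      by_cases hm2 : 2 ≤ q
      · obtain ⟨r, hr, hr', h22⟩ := h22 hm2
        obtain rfl : r = p := by omega
        linarith
      by_cases hn2 : 2 ≤ p
      · obtain ⟨r, hr, hr', h33⟩ := h33 hn2
        obtain rfl : r = q := by omega
        linarith
      obtain rfl : q = 1 := by omega
      obtain rfl : p = 1 := by omega
      exact absurd (by nlinarith : b = c) hbc
    have := h.a_eq_add
    nlinarith
  · have hadj := hadj hp
    have hnon := hnon hpn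
    have ht : t = 0 := by linarith
    have hbc1 : b * c = 1 := by linarith
    have ha' := h.a_eq_add
    have hp' : ((p : ℝ) - 1) * (q - 1) = 1 := by
      subst ha' ht
      have e1 : (p : ℝ) - 1 = b ^ 2 := by linarith
      have e2 : (q : ℝ) - 1 = c ^ 2 := by linarith
      rw [e1, e2, ← mul_pow, hbc1, one_pow]
    obtain ⟨p, rfl⟩ := Nat.exists_eq_add_of_lt hp
    obtain ⟨q, rfl⟩ := Nat.exists_eq_add_of_lt hq
    have : p * q = 1 := by
      have : ((p * q : ℕ) : ℝ) = 1 := by push_cast at hp' ⊢; linarith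
      exact_mod_cast this
    obtain ⟨rfl, rfl⟩ := mul_eq_one.1 this
    exact hbc (by nlinarith)

theorem false_of_joined_both_of_complete_of_edgeless
    (h : PartitionRelations 1 0 1 1 m n p q s t a b c) : False := by
  obtain ⟨ha, hb, hc, hab, hac, hbc, hm, hn, -, -, -, hu, h2, h3, hu2, hu3, h22, h33, hadj, hnon⟩
    := id h
  rcases h.trichotomy with ⟨rfl, rfl⟩ | ⟨rfl, rfl⟩ | ⟨hp, hq, hpn, hqm⟩
  · have hnon := hnon (by omega)
    push_cast at *
    by_cases hn2 : 2 ≤ n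
    · obtain ⟨r, hr, -, h33⟩ := h33 hn2
      obtain rfl : r = 0 := by omega
      push_cast at *
      exact hbc (by nlinarith)
    obtain rfl : n = 1 := by omega
    by_cases hm2 : 2 ≤ m
    · obtain ⟨r, hr, -, h22⟩ := h22 hm2
      obtain rfl : r = 0 := by omega
      push_cast at *
      have := h.a_eq_add
      nlinarith
    obtain rfl : m = 1 := by omega
    push_cast at *
    exact hbc (by nlinarith)
  · exact hab (by nlinarith)
  · have hadj := hadj hp
    have hnon := hnon hpn
    obtain ⟨r, -, -, h33⟩ := h33 (by omega)
    have := h.a_eq_add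
    nlinarith [Nat.cast_nonneg (α := ℝ) r]

theorem false_of_joined_both_of_complete_of_complete
    (h : PartitionRelations 1 1 1 1 m n p q s t a b c) : False := by
  obtain ⟨ha, hb, hc, hab, hac, hbc, hm, hn, -, -, -, hu, h2, h3, hu2, hu3, h22, h33, hadj, hnon⟩
    := id h
  have ha' := h.a_eq_add
  rcases h.trichotomy with ⟨rfl, rfl⟩ | ⟨rfl, rfl⟩ | ⟨hp, hq, hpn, hqm⟩
  · have hnon := hnon (by omega)
    push_cast at *
    by_cases hn2 : 2 ≤ n
    · obtain ⟨r, hr, -, h33⟩ := h33 hn2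
      obtain rfl : r = 0 := by omega
      push_cast at *
      nlinarith
    obtain rfl : n = 1 := by omega
    by_cases hm2 : 2 ≤ m
    · obtain ⟨r, hr, -, h22⟩ := h22 hm2
      obtain rfl : r = 0 := by omega
      push_cast at *
      nlinarith
    obtain rfl : m = 1 := by omega
    push_cast at *
    exact hbc (by nlinarith)
  · exact hab (by nlinarith)
  · have hadj := hadj hp
    have hnon := hnon hpn
    obtain ⟨r, -, -, h33⟩ := h33 (by omega)
    nlinarith [Nat.cast_nonneg (α := ℝ) r, Nat.cast_nonneg (α := ℝ) p]

theorem false_of_joined_two_of_edgeless_of_edgeless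
    (h : PartitionRelations 0 0 1 0 m n p q s t a b c) : False := by
  obtain ⟨ha, hb, hc, hab, hac, hbc, hm, hn, -, -, -, hu, h2, h3, hu2, hu3, h22, h33, hadj, hnon⟩
    := id h
  rcases h.trichotomy with ⟨rfl, rfl⟩ | ⟨rfl, rfl⟩ | ⟨hp, hq, hpn, hqm⟩
  · push_cast at *; nlinarith
  · exact hac (by nlinarith)
  · have hadj := hadj hp
    have hnon := hnon hpn
    nlinarith

theorem false_of_joined_two_of_complete_of_edgeless
    (h : PartitionRelations 1 0 1 0 m n p q s t a b c) : False := by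
  obtain ⟨ha, hb, hc, hab, hac, hbc, hm, hn, -, -, -, hu, h2, h3, hu2, hu3, h22, h33, hadj, hnon⟩
    := id h
  rcases h.trichotomy with ⟨rfl, rfl⟩ | ⟨rfl, rfl⟩ | ⟨hp, hq, hpn, hqm⟩
  · push_cast at *; nlinarith
  · exact hac (by nlinarith)
  · have hadj := hadj hp
    have hnon := hnon hpn
    have : c * (a - b) = 0 := by linarith
    grind

theorem false_of_joined_two_of_edgeless_of_complete
    (h : PartitionRelations 0 1 1 0 m n p q s t a b c) : False := by
  obtain ⟨ha, hb, hc, hab, hac, hbc, hm, hn, -, -, -, hu, h2, h3, hu2, hu3, h22, h33, hadj, hnon⟩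
    := id h
  rcases h.trichotomy with ⟨rfl, rfl⟩ | ⟨rfl, rfl⟩ | ⟨hp, hq, hpn, hqm⟩
  · push_cast at *; nlinarith
  · by_cases hn2 : 2 ≤ p
    · obtain ⟨r, hr, hr', h33⟩ := h33 hn2
      obtain rfl : r = q := by omega
      by_cases hm2 : 2 ≤ r
      · obtain ⟨r', hr1, hr1', h22⟩ := h22 hm2
        obtain rfl : r' = p := by omega
        have hadj := hadj (by omega)
        have hs : s = 0 := by linarith
        have ht : t = -1 := by linarith
        subst hs ht
        have hp2 : (2 : ℝ) ≤ r' := by exact_mod_cast hn2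
        have hr2 : (2 : ℝ) ≤ r := by exact_mod_cast hm2
        have h4 : (r : ℝ) * r = (r : ℝ) * (r' - 1 + r) := by
          calc (r : ℝ) * r = a ^ 2 * c ^ 2 := by
                rw [← mul_pow, ← show (r : ℝ) = a * c by linarith]; ring
            _ = r * (r' - 1 + r) := by
                rw [show a ^ 2 = (r : ℝ) by linarith, show c ^ 2 = (r' : ℝ) - 1 + r by linarith]
        nlinarith
      obtain rfl : r = 1 := by omega
      push_cast at *
      exact hab (by nlinarith)
    obtain rfl : p = 1 := by omega
    push_cast at *
    exact hac (by nlinarith)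
  · have hadj := hadj hp
    have hnon := hnon hpn
    obtain ⟨r, -, -, h22⟩ := h22 (by omega)
    have ht : t = -1 := by linarith
    have hab1 : (a * b) ^ 2 = 1 := by rw [show a * b = 1 by linarith, one_pow]
    have ea : a ^ 2 = ((m - p + r : ℤ) : ℝ) := by push_cast; linarith
    have eb : b ^ 2 = ((1 + r : ℤ) : ℝ) := by push_cast; linarith
    have hprod : (m - p + r : ℤ) * (1 + r : ℤ) = 1 := by
      rw [mul_pow, ea, eb] at hab1
      exact_mod_cast hab1
    have hr0 : (1 + r : ℤ) = 1 := by
      rcases Int.eq_one_or_neg_one_of_mul_eq_one' hprod with ⟨_, h⟩ | ⟨_, h⟩ <;> omega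
    rw [hr0, mul_one] at hprod
    rw [hprod] at ea
    rw [hr0] at eb
    exact hab (by nlinarith)

theorem false_of_joined_two_of_complete_of_complete
    (h : PartitionRelations 1 1 1 0 m n p q s t a b c) : False := by
  obtain ⟨ha, hb, hc, hab, hac, hbc, hm, hn, -, -, hcount, hu, h2, h3, hu2, hu3, h22, h33, hadj,
    hnon⟩ := id h
  rcases h.trichotomy with ⟨rfl, rfl⟩ | ⟨rfl, rfl⟩ | ⟨hp, hq, hpn, hqm⟩
  · push_cast at *; nlinarith
  · by_cases hn2 : 2 ≤ p
    · obtain ⟨r, hr, hr', h33⟩ := h33 hn2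
      obtain rfl : r = q := by omega
      have : a * (a - b) = 0 := by linarith
      grind
    obtain rfl : p = 1 := by omega
    push_cast at *
    exact hac (by nlinarith)
  · have hadj := hadj hp
    have hnon := hnon hpn
    have ht : t = -2 := by linarith
    have hp' : (0 : ℝ) < p := by exact_mod_cast hp
    have hcount : (m : ℝ) * p = n * q := by exact_mod_cast hcount
    have hpe : (p : ℝ) = b ^ 2 - a ^ 2 := by linarith
    have hlt : a < b := by nlinarith
    have hqe : (q : ℝ) = a * c := by linarith
    have hce : c = a + b := by
      have : (b - a) * (c - (a + b)) = 0 := by linear_combination -hnon + hpe + hqe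
      grind
    have hme : (m : ℝ) = a * b - 1 := by linarith
    have hne : (n : ℝ) = b ^ 2 + 2 * a * b - a ^ 2 := by
      subst hce
      linear_combination h3 - hqe - hu + hme
    rw [hme, hne, hqe, hpe, hce] at hcount
    have : (a + b) * (a * (1 + a ^ 2) - b * (1 + 3 * a ^ 2)) = 0 := by linear_combination hcount
    have : a * (1 + a ^ 2) - b * (1 + 3 * a ^ 2) = 0 := by
      rcases mul_eq_zero.1 this with h | h
      · linarith
      · exact h
    nlinarith [mul_pos ha ha]

theorem false_of_joined_neither
    (h : PartitionRelations k l 0 0 m n p q s t a b c) : False := by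
  have := h.u_two
  nlinarith [mul_pos h.a_pos h.b_pos]

protected theorem false (hk : k = 0 ∨ k = 1) (hl : l = 0 ∨ l = 1) (he : e = 0 ∨ e = 1)
    (hf : f = 0 ∨ f = 1) (h : PartitionRelations k l e f m n p q s t a b c) : False := by
  rcases he with rfl | rfl <;> rcases hf with rfl | rfl
  · exact h.false_of_joined_neither
  · replace h := h.swap
    rcases hk with rfl | rfl <;> rcases hl with rfl | rfl
    · exact h.false_of_joined_two_of_edgeless_of_edgeless
    · exact h.false_of_joined_two_of_complete_of_edgeless
    · exact h.false_of_joined_two_of_edgeless_of_complete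
    · exact h.false_of_joined_two_of_complete_of_complete
  · rcases hk with rfl | rfl <;> rcases hl with rfl | rfl
    · exact h.false_of_joined_two_of_edgeless_of_edgeless
    · exact h.false_of_joined_two_of_edgeless_of_complete
    · exact h.false_of_joined_two_of_complete_of_edgeless
    · exact h.false_of_joined_two_of_complete_of_complete
  · rcases hk with rfl | rfl <;> rcases hl with rfl | rfl
    · exact h.false_of_joined_both_of_edgeless_of_edgeless
    · exact h.swap.false_of_joined_both_of_complete_of_edgeless
    · exact h.false_of_joined_both_of_complete_of_edgeless
    · exact h.false_of_joined_both_of_complete_of_complete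

end PartitionRelations

namespace SimpleGraph

variable {V : Type*} (G : SimpleGraph V) [DecidableRel G.Adj]

theorem sum_adjMatrix_mul_of_const [DecidableEq V] {S : Finset V} {k : ℝ}
    (hS : ∀ x ∈ S, ∀ y ∈ S, G.adjMatrix ℝ x y = if x = y then 0 else k) {x : V} (hx : x ∈ S)
    (g : V → ℝ) : ∑ z ∈ S, G.adjMatrix ℝ x z * g z = k * (∑ z ∈ S, g z - g x) := by
  have : ∀ z ∈ S, G.adjMatrix ℝ x z * g z = k * g z - if x = z then k * g z else 0 := by
    intro z hz
    rw [hS x hx z hz]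
    split_ifs <;> ring
  rw [Finset.sum_congr rfl this, Finset.sum_sub_distrib, Finset.sum_ite_eq, if_pos hx,
    ← Finset.mul_sum, mul_sub]

theorem adjMatrix_comm (x y : V) : G.adjMatrix ℝ x y = G.adjMatrix ℝ y x := by
  simp [G.adj_comm]

theorem exists_adjMatrix_eq_of_complete_or_edgeless [DecidableEq V] {S : Finset V}
    (hS : (∀ x ∈ S, ∀ y ∈ S, x ≠ y → G.Adj x y) ∨ (∀ x ∈ S, ∀ y ∈ S, ¬ G.Adj x y)) :
    ∃ k : ℝ, (k = 0 ∨ k = 1) ∧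
      ∀ x ∈ S, ∀ y ∈ S, G.adjMatrix ℝ x y = if x = y then 0 else k := by
  rcases hS with h | h
  · refine ⟨1, .inr rfl, fun x hx y hy => ?_⟩
    split_ifs with hxy
    · simp [hxy]
    · simp [h x hx y hy hxy]
  · exact ⟨0, .inl rfl, fun x hx y hy => by simp [h x hx y hy]⟩

theorem exists_adjMatrix_eq_of_joined {u : V} {S : Finset V}
    (hS : (∀ x ∈ S, G.Adj u x) ∨ (∀ x ∈ S, ¬ G.Adj u x)) :
    ∃ e : ℝ, (e = 0 ∨ e = 1) ∧ ∀ x ∈ S, G.adjMatrix ℝ u x = e := by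
  rcases hS with h | h
  · exact ⟨1, .inr rfl, fun x hx => by simp [h x hx]⟩
  · exact ⟨0, .inl rfl, fun x hx => by simp [h x hx]⟩

theorem sum_adjMatrix_eq_card (T : Finset V) (x : V) :
    ∑ z ∈ T, G.adjMatrix ℝ x z = (T.filter fun z => G.Adj x z).card := by
  simp [Finset.sum_boole]

theorem exists_sum_adjMatrix_mul_adjMatrix [DecidableEq V] {T : Finset V} {p : ℕ} {x y : V}
    (hx : (T.filter fun z => G.Adj x z).card = p) (hy : (T.filter fun z => G.Adj y z).card = p) :
    ∃ r : ℕ, r ≤ p ∧ 2 * p ≤ T.card + r ∧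
      ∑ z ∈ T, G.adjMatrix ℝ x z * G.adjMatrix ℝ z y = r := by
  refine ⟨((T.filter fun z => G.Adj x z) ∩ T.filter fun z => G.Adj y z).card,
    hx ▸ Finset.card_le_card Finset.inter_subset_left, ?_, ?_⟩
  · have h1 := Finset.card_union_add_card_inter (T.filter fun z => G.Adj x z)
      (T.filter fun z => G.Adj y z)
    have h2 : ((T.filter fun z => G.Adj x z) ∪ T.filter fun z => G.Adj y z).card ≤ T.card :=
      Finset.card_le_card (Finset.union_subset (Finset.filter_subset _ _)
        (Finset.filter_subset _ _))
    omega
  · rw [← Finset.filter_and, ← Finset.sum_boole]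
    refine Finset.sum_congr rfl fun z _ => ?_
    simp only [adjMatrix_apply, G.adj_comm z y, ite_and, mul_ite, mul_one, mul_zero]
    split_ifs <;> rfl

/-- The entries of `A ^ 2` when `(A - θ1) (A - θ2) = α αᵀ`. -/
theorem sum_adjMatrix_mul_adjMatrix_of_rank_one [Fintype V] [DecidableEq V] {θ1 θ2 : ℝ} {α : V → ℝ}
    (h : (G.adjMatrix ℝ - θ1 • 1) * (G.adjMatrix ℝ - θ2 • 1) = Matrix.vecMulVec α α) (x y : V) :
    ∑ z, G.adjMatrix ℝ x z * G.adjMatrix ℝ z y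
      = (θ1 + θ2) * G.adjMatrix ℝ x y + (if x = y then -(θ1 * θ2) else 0) + α x * α y := by
  have h1 := congrFun (congrFun h x) y
  simp only [sub_mul, mul_sub, smul_mul_assoc, mul_smul_comm, one_mul, mul_one,
    Matrix.sub_apply, Matrix.smul_apply, Matrix.vecMulVec_apply, smul_eq_mul,
    Matrix.one_apply] at h1
  rw [Matrix.mul_apply] at h1
  rw [← h1]
  split_ifs <;> ring

theorem degree_eq_of_rank_one [Fintype V] [DecidableEq V] {θ1 θ2 : ℝ} {α : V → ℝ}
    (h : (G.adjMatrix ℝ - θ1 • 1) * (G.adjMatrix ℝ - θ2 • 1) = Matrix.vecMulVec α α) (x : V) :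
    (G.degree x : ℝ) = α x ^ 2 + -(θ1 * θ2) := by
  have h1 := G.sum_adjMatrix_mul_adjMatrix_of_rank_one h x x
  rw [← Matrix.mul_apply, adjMatrix_mul_self_apply_self] at h1
  rw [h1]
  simp
  ring

theorem exists_partitionRelations [Fintype V] [DecidableEq V] {θ1 θ2 : ℝ} {α : V → ℝ}
    (hα : ∀ x, 0 < α x)
    (h : (G.adjMatrix ℝ - θ1 • 1) * (G.adjMatrix ℝ - θ2 • 1) = Matrix.vecMulVec α α)
    {u : V} {S T : Finset V} (hS : S.Nonempty) (hT : T.Nonempty)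
    (hST : Disjoint S T) (hcover : S ∪ T = Finset.univ.erase u) {k l e f : ℝ} {p q d d' : ℕ}
    (hk : ∀ x ∈ S, ∀ y ∈ S, G.adjMatrix ℝ x y = if x = y then 0 else k)
    (hl : ∀ x ∈ T, ∀ y ∈ T, G.adjMatrix ℝ x y = if x = y then 0 else l)
    (he : ∀ x ∈ S, G.adjMatrix ℝ u x = e) (hf : ∀ x ∈ T, G.adjMatrix ℝ u x = f)
    (he01 : e = 0 ∨ e = 1) (hf01 : f = 0 ∨ f = 1) (hk01 : k = 0 ∨ k = 1) (hl01 : l = 0 ∨ l = 1)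
    (hp : ∀ x ∈ S, (T.filter fun y => G.Adj x y).card = p)
    (hq : ∀ y ∈ T, (S.filter fun x => G.Adj y x).card = q)
    (hd : ∀ x ∈ S, G.degree x = d) (hd' : ∀ x ∈ T, G.degree x = d')
    (hud : G.degree u ≠ d) (hud' : G.degree u ≠ d') (hdd' : d ≠ d') :
    ∃ s t a b c : ℝ, PartitionRelations k l e f S.card T.card p q s t a b c := by
  have hdeg := G.degree_eq_of_rank_one h
  have hsq := G.sum_adjMatrix_mul_adjMatrix_of_rank_one h
  have hαne : ∀ x y, G.degree x ≠ G.degree y → α x ≠ α y := by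
    intro x y hxy h
    refine hxy ?_
    have := hdeg x
    rw [h, ← hdeg y] at this
    exact_mod_cast this
  have hαeq : ∀ x y, G.degree x = G.degree y → α x = α y := by
    intro x y hxy
    have h1 := hdeg x
    rw [hxy, hdeg y] at h1
    have := hα x
    have := hα y
    nlinarith
  obtain ⟨x0, hx0⟩ := hS
  obtain ⟨y0, hy0⟩ := hT
  have hb : ∀ x ∈ S, α x = α x0 := fun x hx => hαeq _ _ ((hd x hx).trans (hd x0 hx0).symm)
  have hc : ∀ x ∈ T, α x = α y0 := fun x hx => hαeq _ _ ((hd' x hx).trans (hd' y0 hy0).symm)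
  have hsum : ∀ g : V → ℝ, ∑ z, g z = g u + ∑ z ∈ S, g z + ∑ z ∈ T, g z := by
    intro g
    rw [← Finset.add_sum_erase _ g (Finset.mem_univ u), ← hcover, Finset.sum_union hST, add_assoc]
  have hu : ∀ x, x ∈ S ∨ x ∈ T → u ≠ x := by
    rintro x hx rfl
    have : u ∈ Finset.univ.erase u := hcover ▸ Finset.mem_union.2 hx
    simp at this
  have huu : G.adjMatrix ℝ u u = 0 := by simp
  have hSS : ∀ x ∈ S, ∑ z ∈ S, G.adjMatrix ℝ x z = k * (S.card - 1) := by
    intro x hx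
    simpa using G.sum_adjMatrix_mul_of_const hk hx 1
  have hTT : ∀ x ∈ T, ∑ z ∈ T, G.adjMatrix ℝ x z = l * (T.card - 1) := by
    intro x hx
    simpa using G.sum_adjMatrix_mul_of_const hl hx 1
  have hST' : ∀ x ∈ S, ∑ z ∈ T, G.adjMatrix ℝ x z = p := by
    intro x hx
    rw [sum_adjMatrix_eq_card, hp x hx]
  have hTS' : ∀ x ∈ T, ∑ z ∈ S, G.adjMatrix ℝ x z = q := by
    intro x hx
    rw [sum_adjMatrix_eq_card, hq x hx]
  have hdegsum : ∀ x, ∑ z, G.adjMatrix ℝ x z = α x ^ 2 + -(θ1 * θ2) := by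
    intro x
    rw [← hdeg, sum_adjMatrix_eq_card]
    simp [← card_neighborFinset_eq_degree, neighborFinset_eq_filter]
  have hcomm : ∀ (x : V) (U : Finset V), ∑ z ∈ U, G.adjMatrix ℝ z x = ∑ z ∈ U, G.adjMatrix ℝ x z :=
    fun x U => Finset.sum_congr rfl fun z _ => G.adjMatrix_comm z x
  have hfromu : ∀ x, e * ∑ z ∈ S, G.adjMatrix ℝ x z + f * ∑ z ∈ T, G.adjMatrix ℝ x z
      = ∑ z, G.adjMatrix ℝ u z * G.adjMatrix ℝ z x := by
    intro x
    rw [hsum, huu, zero_mul, zero_add, ← hcomm, ← hcomm, Finset.mul_sum, Finset.mul_sum]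
    congr 1
    · exact Finset.sum_congr rfl fun z hz => by rw [he z hz]
    · exact Finset.sum_congr rfl fun z hz => by rw [hf z hz]
  have hcross : ∀ x ∈ S, ∀ y ∈ T, e * f + k * (q - G.adjMatrix ℝ x y)
      + l * (p - G.adjMatrix ℝ x y) = (θ1 + θ2) * G.adjMatrix ℝ x y + α x0 * α y0 := by
    intro x hx y hy
    have h1 := hsq x y
    have hxy : x ≠ y := fun hxy => Finset.disjoint_left.1 hST hx (hxy ▸ hy)
    rw [hsum, G.adjMatrix_comm x u, he x hx, hf y hy, if_neg hxy, hb x hx, hc y hy,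
      G.sum_adjMatrix_mul_of_const hk hx fun z => G.adjMatrix ℝ z y, hcomm y S, hTS' y hy] at h1
    have h2 : ∑ z ∈ T, G.adjMatrix ℝ x z * G.adjMatrix ℝ z y = l * (p - G.adjMatrix ℝ x y) := by
      rw [← hST' x hx, G.adjMatrix_comm x y, ← hcomm x T,
        ← G.sum_adjMatrix_mul_of_const hl hy fun z => G.adjMatrix ℝ z x]
      exact Finset.sum_congr rfl fun z _ => by
        rw [G.adjMatrix_comm x z, G.adjMatrix_comm z y, mul_comm]
    linarith
  have sq01 : ∀ {r : ℝ}, (r = 0 ∨ r = 1) → r * r = r := by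
    rintro r (rfl | rfl) <;> simp
  refine ⟨-(θ1 * θ2), θ1 + θ2, α u, α x0, α y0, hα u, hα x0, hα y0, ?_, ?_, ?_,
    Finset.card_pos.2 ⟨x0, hx0⟩, Finset.card_pos.2 ⟨y0, hy0⟩, ?_, ?_, ?_, ?_, ?_, ?_, ?_, ?_,
    ?_, ?_, ?_, ?_⟩
  · exact hαne _ _ (by rwa [hd x0 hx0])
  · exact hαne _ _ (by rwa [hd' y0 hy0])
  · exact hαne _ _ (by rwa [hd x0 hx0, hd' y0 hy0])
  · exact hp x0 hx0 ▸ Finset.card_le_card (Finset.filter_subset _ _)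
  · exact hq y0 hy0 ▸ Finset.card_le_card (Finset.filter_subset _ _)
  · have h1 : ∑ x ∈ S, ∑ y ∈ T, G.adjMatrix ℝ x y = S.card * p := by
      rw [Finset.sum_congr rfl hST']; simp
    have h2 : ∑ y ∈ T, ∑ x ∈ S, G.adjMatrix ℝ x y = T.card * q := by
      rw [Finset.sum_congr rfl fun y hy => (hcomm y S).trans (hTS' y hy)]; simp
    have h3 := h1.symm.trans (Finset.sum_comm.trans h2)
    exact_mod_cast h3
  · rw [← hdegsum, hsum, huu, Finset.sum_congr rfl he, Finset.sum_congr rfl hf]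
    simp
    ring
  · rw [← hdegsum, hsum, G.adjMatrix_comm x0 u, he x0 hx0, hSS x0 hx0, hST' x0 hx0]
  · rw [← hdegsum, hsum, G.adjMatrix_comm y0 u, hf y0 hy0, hTT y0 hy0, hTS' y0 hy0]
    ring
  · have h1 := hfromu x0
    rw [hSS x0 hx0, hST' x0 hx0, hsq, he x0 hx0, if_neg (hu x0 (.inl hx0))] at h1
    linarith
  · have h1 := hfromu y0
    rw [hTS' y0 hy0, hTT y0 hy0, hsq, hf y0 hy0, if_neg (hu y0 (.inr hy0))] at h1
    linarith
  · intro hS2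
    obtain ⟨x, hx, y, hy, hxy⟩ := Finset.one_lt_card.1 hS2
    obtain ⟨r, hr, hr', h1⟩ := G.exists_sum_adjMatrix_mul_adjMatrix (hp x hx) (hp y hy)
    refine ⟨r, hr, hr', ?_⟩
    have h2 := hsq x y
    rw [hsum, h1, G.sum_adjMatrix_mul_of_const hk hx fun z => G.adjMatrix ℝ z y, hcomm, hSS y hy,
      G.adjMatrix_comm x u, he x hx, he y hy, hk x hx y hy, if_neg hxy, if_neg hxy, hb x hx,
      hb y hy] at h2
    linear_combination h2 - sq01 he01 - (S.card - 2 : ℝ) * sq01 hk01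
  · intro hT2
    obtain ⟨x, hx, y, hy, hxy⟩ := Finset.one_lt_card.1 hT2
    obtain ⟨r, hr, hr', h1⟩ := G.exists_sum_adjMatrix_mul_adjMatrix (hq x hx) (hq y hy)
    refine ⟨r, hr, hr', ?_⟩
    have h2 := hsq x y
    rw [hsum, h1, G.sum_adjMatrix_mul_of_const hl hx fun z => G.adjMatrix ℝ z y, hcomm, hTT y hy,
      G.adjMatrix_comm x u, hf x hx, hf y hy, hl x hx y hy, if_neg hxy, if_neg hxy, hc x hx,
      hc y hy] at h2
    linear_combination h2 - sq01 hf01 - (T.card - 2 : ℝ) * sq01 hl01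
  · intro hp0
    rw [← hp x0 hx0, Finset.card_pos] at hp0
    obtain ⟨y, hy⟩ := hp0
    rw [Finset.mem_filter] at hy
    have h1 := hcross x0 hx0 y hy.1
    simpa [hy.2] using h1
  · intro hpn
    rw [← hp x0 hx0] at hpn
    obtain ⟨y, hy, hxy⟩ : ∃ y ∈ T, ¬ G.Adj x0 y := by
      by_contra! hall
      rw [Finset.filter_true_of_mem hall] at hpn
      exact hpn.ne rfl
    have h1 := hcross x0 hx0 y hy
    simpa [hxy] using h1

end SimpleGraph

/-- No graph in `𝒢₃` has a vertex `u` and a partition of the remaining vertices into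
nonempty parts `V2, V3` inducing complete or edgeless subgraphs, with `u` joined to all or
none of each part, with the bipartite graph between `V2` and `V3` biregular, and with the
three degrees (of `u`, of `V2`-vertices, and of `V3`-vertices) pairwise distinct. -/
theorem stmt16 {V : Type} [Fintype V] [DecidableEq V] (G : SimpleGraph V) [DecidableRel G.Adj]
    (θ0 θ1 θ2 : ℝ) (h : InG3 G θ0 θ1 θ2)
    (u : V) (V2 V3 : Finset V) (hV2 : V2.Nonempty) (hV3 : V3.Nonempty)
    (h23 : Disjoint V2 V3) (hcover : V2 ∪ V3 = Finset.univ.erase u)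
    (hV2ind : (∀ x ∈ V2, ∀ y ∈ V2, x ≠ y → G.Adj x y) ∨ (∀ x ∈ V2, ∀ y ∈ V2, ¬ G.Adj x y))
    (hV3ind : (∀ x ∈ V3, ∀ y ∈ V3, x ≠ y → G.Adj x y) ∨ (∀ x ∈ V3, ∀ y ∈ V3, ¬ G.Adj x y))
    (hu2 : (∀ x ∈ V2, G.Adj u x) ∨ (∀ x ∈ V2, ¬ G.Adj u x))
    (hu3 : (∀ x ∈ V3, G.Adj u x) ∨ (∀ x ∈ V3, ¬ G.Adj u x))
    (hbireg1 : ∃ e : ℕ, ∀ x ∈ V2, (V3.filter (fun y => G.Adj x y)).card = e)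
    (hbireg2 : ∃ e : ℕ, ∀ y ∈ V3, (V2.filter (fun x => G.Adj x y)).card = e)
    (d2 d3 : ℕ)
    (hd2 : ∀ x ∈ V2, G.degree x = d2) (hd3 : ∀ x ∈ V3, G.degree x = d3)
    (hdist : G.degree u ≠ d2 ∧ G.degree u ≠ d3 ∧ d2 ≠ d3) :
    False := by
  obtain ⟨α, hα, hM⟩ := h.exists_pos_rank_one
  obtain ⟨k, hk01, hk⟩ := G.exists_adjMatrix_eq_of_complete_or_edgeless hV2ind
  obtain ⟨l, hl01, hl⟩ := G.exists_adjMatrix_eq_of_complete_or_edgeless hV3ind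
  obtain ⟨e, he01, he⟩ := G.exists_adjMatrix_eq_of_joined hu2
  obtain ⟨f, hf01, hf⟩ := G.exists_adjMatrix_eq_of_joined hu3
  obtain ⟨p, hp⟩ := hbireg1
  obtain ⟨q, hq⟩ := hbireg2
  obtain ⟨s, t, a, b, c, hrel⟩ := G.exists_partitionRelations hα hM hV2 hV3 h23 hcover hk hl he hf
    he01 hf01 hk01 hl01 hp (by simpa only [G.adj_comm] using hq) hd2 hd3 hdist.1 hdist.2.1 hdist.2.2
  exact hrel.false hk01 hl01 he01 hf01
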